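/- For all a, b, a', b' in the finite field F = GF(3^5), the map ψ_{a,b} of F^4 sending (u, t, r, s) to (u, t + h_{(a,b)}(r,s) − g_{(a,b)}(u), r − u·a, s − u·b) maps the set E*(a',b') = { (t, h_{(a',b')}(r,s) + g_{(a',b')}(t), r, s) : t, r, s ∈ F } onto the set E*(a+a', b+b') = { (t, h_{(a+a',b+b')}(r,s) + g_{(a+a',b+b')}(t), r, s) : t, r, s ∈ F }; that is, the image of E*(a',b') under ψ_{a,b} equals E*(a+a', b+b'). (The collineation ψ_{a,b} acts on the tangent spaces of the dual Penttila–Williams egg by translation, fixing E*_∞ setwise.) -/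

import Mathlib

/-- `F = GF(3^5)`, the finite field with `3^5 = 243` elements. -/
abbrev F : Type := GaloisField 3 5

/-- `g_{(a,b)}(t) = a^2*t - (b^2)^9*t^9 + (a*b)^81*t^81`. -/
noncomputable def g (a b t : F) : F :=
  a ^ 2 * t - (b ^ 2) ^ 9 * t ^ 9 + (a * b) ^ 81 * t ^ 81

/-- `h_{(a,b)}(r,s) = -a*r + b^9*s^9 + (b*r + a*s)^81`. -/
noncomputable def h (a b r s : F) : F :=
  -a * r + b ^ 9 * s ^ 9 + (b * r + a * s) ^ 81

/-- The collineation `ψ_{a,b} : (u,t,r,s) ↦ (u, t + h_{(a,b)}(r,s) - g_{(a,b)}(u),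
r - u*a, s - u*b)`. -/
noncomputable def psi (a b : F) (p : F × F × F × F) : F × F × F × F :=
  (p.1, p.2.1 + h a b p.2.2.1 p.2.2.2 - g a b p.1,
    p.2.2.1 - p.1 * a, p.2.2.2 - p.1 * b)

theorem add_pow_nine (x y : F) : (x + y) ^ 9 = x ^ 9 + y ^ 9 :=
  add_pow_char_pow (p := 3) (n := 2) x y

theorem sub_pow_nine (x y : F) : (x - y) ^ 9 = x ^ 9 - y ^ 9 :=
  sub_pow_char_pow (p := 3) (n := 2) x y

theorem add_pow_eighty_one (x y : F) : (x + y) ^ 81 = x ^ 81 + y ^ 81 :=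
  add_pow_char_pow (p := 3) (n := 4) x y

theorem sub_pow_eighty_one (x y : F) : (x - y) ^ 81 = x ^ 81 - y ^ 81 :=
  sub_pow_char_pow (p := 3) (n := 4) x y

/-- `ψ_{a,b}` carries the point of `E*(a',b')` with parameters `(t, r, s)` to the point of
`E*(a+a',b+b')` with parameters `(t, r - t*a, s - t*b)`. -/
theorem psi_apply_tangent_point (a b a' b' t r s : F) :
    psi a b (t, h a' b' r s + g a' b' t, r, s) =
      (t, h (a + a') (b + b') (r - t * a) (s - t * b) + g (a + a') (b + b') t,
        r - t * a, s - t * b) := by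
  have three_eq_zero : (3 : F) = 0 := by exact_mod_cast CharP.cast_eq_zero F 3
  simp only [psi, g, h, Prod.mk.injEq, true_and, and_true]
  simp only [mul_pow, add_pow_eighty_one, sub_pow_eighty_one, sub_pow_nine,
    pow_right_comm _ 2 9, add_pow_nine]
  linear_combination
    (-(a ^ 2 + a * a') * t + ((b ^ 9) ^ 2 + b ^ 9 * b' ^ 9) * t ^ 9) * three_eq_zero

/-- `ψ_{a,b}` maps the tangent space `E*(a',b')` of the dual Penttila–Williams
egg onto `E*(a+a', b+b')`. -/
theorem psi_maps_tangent_spaces (a b a' b' : F) :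
    psi a b '' {p : F × F × F × F | ∃ t r s : F,
        p = (t, h a' b' r s + g a' b' t, r, s)} =
    {p : F × F × F × F | ∃ t r s : F,
        p = (t, h (a + a') (b + b') r s + g (a + a') (b + b') t, r, s)} := by
  ext p
  constructor
  · rintro ⟨_, ⟨t, r, s, rfl⟩, rfl⟩
    exact ⟨t, r - t * a, s - t * b, psi_apply_tangent_point a b a' b' t r s⟩
  · rintro ⟨t, r, s, rfl⟩
    refine ⟨_, ⟨t, r + t * a, s + t * b, rfl⟩, ?_⟩
    rw [psi_apply_tangent_point, add_sub_cancel_right, add_sub_cancel_right]
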